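/- If X1 and X2 are conditionally independent given U (all random variables taking values in finite sets, jointly distributed with a further random variable Y), then I(X1,X2 ; Y | U) ≤ I(X1 ; Y | U, X2) + I(X2 ; Y | U, X1). -/

import Mathlib

open MeasureTheory

namespace SF

variable {Ω : Type*} [MeasurableSpace Ω]

/-- The probability that a random variable `X` takes the value `a`. -/
noncomputable def pr (μ : Measure Ω) {A : Type*} (X : Ω → A) (a : A) : ℝ :=
  (μ (X ⁻¹' {a})).toReal

/-- Shannon entropy (natural logarithm) of a finite-valued random variable. -/
noncomputable def ent (μ : Measure Ω) {A : Type*} [Fintype A] (X : Ω → A) : ℝ :=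
  ∑ a, Real.negMulLog (pr μ X a)

/-- Conditional entropy `H(X | Y)`. -/
noncomputable def condEnt (μ : Measure Ω) {A B : Type*} [Fintype A] [Fintype B]
    (X : Ω → A) (Y : Ω → B) : ℝ :=
  ent μ (fun ω => (X ω, Y ω)) - ent μ Y

/-- Mutual information `I(X ; Y)`. -/
noncomputable def mi (μ : Measure Ω) {A B : Type*} [Fintype A] [Fintype B]
    (X : Ω → A) (Y : Ω → B) : ℝ :=
  ent μ X + ent μ Y - ent μ (fun ω => (X ω, Y ω))

/-- Conditional mutual information `I(X ; Y | Z)`. -/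
noncomputable def cmi (μ : Measure Ω) {A B C : Type*} [Fintype A] [Fintype B] [Fintype C]
    (X : Ω → A) (Y : Ω → B) (Z : Ω → C) : ℝ :=
  ent μ (fun ω => (X ω, Z ω)) + ent μ (fun ω => (Y ω, Z ω))
    - ent μ (fun ω => (X ω, Y ω, Z ω)) - ent μ Z

end SF

open SF MeasureTheory

/-- Entropy gap between a matrix and its marginals, as a sum over the entries. -/
theorem sum_negMulLog_marginals_sub {A B : Type*} [Fintype A] [Fintype B] (q : A → B → ℝ) :
    (∑ a, Real.negMulLog (∑ b, q a b)) + (∑ b, Real.negMulLog (∑ a, q a b))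
      - (∑ a, ∑ b, Real.negMulLog (q a b)) - Real.negMulLog (∑ a, ∑ b, q a b)
      = ∑ a, ∑ b, (q a b * Real.log (q a b) + q a b * Real.log (∑ a, ∑ b, q a b)
        - q a b * Real.log (∑ b, q a b) - q a b * Real.log (∑ a, q a b)) := by
  have hcol : ∑ a, ∑ b, q a b * Real.log (∑ a, q a b)
      = ∑ b, (∑ a, q a b) * Real.log (∑ a, q a b) := by
    rw [Finset.sum_comm]
    simp only [← Finset.sum_mul]
  simp only [Finset.sum_add_distrib, Finset.sum_sub_distrib, hcol, ← Finset.sum_mul,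
    Real.negMulLog, neg_mul, Finset.sum_neg_distrib]
  ring

section NonnegMatrix

variable {A B : Type*} {q : A → B → ℝ} {a : A} {b : B}

theorem row_sum_pos [Fintype B] (hq : ∀ a b, 0 ≤ q a b) (h : 0 < q a b) : 0 < ∑ b, q a b :=
  h.trans_le (Finset.single_le_sum (f := fun b => q a b) (fun b _ => hq a b) (Finset.mem_univ b))

theorem col_sum_pos [Fintype A] (hq : ∀ a b, 0 ≤ q a b) (h : 0 < q a b) : 0 < ∑ a, q a b :=
  h.trans_le (Finset.single_le_sum (f := fun a => q a b) (fun a _ => hq a b) (Finset.mem_univ a))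

theorem total_sum_pos [Fintype A] [Fintype B] (hq : ∀ a b, 0 ≤ q a b) (h : 0 < q a b) :
    0 < ∑ a, ∑ b, q a b :=
  (row_sum_pos hq h).trans_le (Finset.single_le_sum (f := fun a => ∑ b, q a b)
    (fun a _ => Finset.sum_nonneg fun b _ => hq a b) (Finset.mem_univ a))

end NonnegMatrix

/-- Subadditivity of `-x log x` sums for a nonnegative matrix of arbitrary total mass. -/
theorem sum_negMulLog_marginals_sub_nonneg {A B : Type*} [Fintype A] [Fintype B] (q : A → B → ℝ)
    (hq : ∀ a b, 0 ≤ q a b) :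
    0 ≤ (∑ a, Real.negMulLog (∑ b, q a b)) + (∑ b, Real.negMulLog (∑ a, q a b))
      - (∑ a, ∑ b, Real.negMulLog (q a b)) - Real.negMulLog (∑ a, ∑ b, q a b) := by
  rw [sum_negMulLog_marginals_sub]
  set r : A → ℝ := fun a => ∑ b, q a b
  set s : B → ℝ := fun b => ∑ a, q a b
  set t : ℝ := ∑ a, ∑ b, q a b
  have hr0 : ∀ a, 0 ≤ r a := fun a => Finset.sum_nonneg fun b _ => hq a b
  have hs0 : ∀ b, 0 ≤ s b := fun b => Finset.sum_nonneg fun a _ => hq a b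
  have ht0 : 0 ≤ t := Finset.sum_nonneg fun a _ => hr0 a
  have entrywise : ∀ a b, q a b - r a * s b / t ≤
      q a b * Real.log (q a b) + q a b * Real.log t
        - q a b * Real.log (r a) - q a b * Real.log (s b) := by
    intro a b
    rcases (hq a b).eq_or_lt with h | h
    · rw [← h]
      have : 0 ≤ r a * s b / t := div_nonneg (mul_nonneg (hr0 a) (hs0 b)) ht0
      linarith
    · have hra : 0 < r a := row_sum_pos hq h
      have hsb : 0 < s b := col_sum_pos hq h
      have htp : 0 < t := total_sum_pos hq h
      have key := Real.log_le_sub_one_of_pos (x := r a * s b / (q a b * t)) (by positivity)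
      rw [Real.log_div (by positivity) (by positivity), Real.log_mul hra.ne' hsb.ne',
        Real.log_mul h.ne' htp.ne'] at key
      have scaled := mul_le_mul_of_nonneg_left key h.le
      have cancel : q a b * (r a * s b / (q a b * t) - 1) = r a * s b / t - q a b := by
        field_simp
      rw [cancel] at scaled
      linarith
  have hprod : ∑ a, ∑ b, r a * s b / t = t := by
    have hst : ∑ b, s b = t := Finset.sum_comm
    simp_rw [← Finset.sum_div, ← Finset.mul_sum, hst, ← Finset.sum_mul]
    exact mul_self_div_self t
  have hzero : ∑ a, ∑ b, (q a b - r a * s b / t) = 0 := by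
    simp only [Finset.sum_sub_distrib, hprod]
    exact sub_self t
  rw [← hzero]
  exact Finset.sum_le_sum fun a _ => Finset.sum_le_sum fun b _ => entrywise a b

/-- Equality case of `sum_negMulLog_marginals_sub_nonneg`: a matrix of rank one. -/
theorem sum_negMulLog_marginals_sub_eq_zero {A B : Type*} [Fintype A] [Fintype B] (q : A → B → ℝ)
    (hq : ∀ a b, 0 ≤ q a b)
    (hprod : ∀ a b, q a b * (∑ a, ∑ b, q a b) = (∑ b, q a b) * ∑ a, q a b) :
    (∑ a, Real.negMulLog (∑ b, q a b)) + (∑ b, Real.negMulLog (∑ a, q a b))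
      - (∑ a, ∑ b, Real.negMulLog (q a b)) - Real.negMulLog (∑ a, ∑ b, q a b) = 0 := by
  rw [sum_negMulLog_marginals_sub]
  refine Finset.sum_eq_zero fun a _ => Finset.sum_eq_zero fun b _ => ?_
  rcases (hq a b).eq_or_lt with h | h
  · simp [← h]
  · have hlog := congrArg Real.log (hprod a b)
    rw [Real.log_mul h.ne' (total_sum_pos hq h).ne',
      Real.log_mul (row_sum_pos hq h).ne' (col_sum_pos hq h).ne'] at hlog
    linear_combination q a b * hlog

section Entropy

variable {Ω : Type*} [MeasurableSpace Ω] (μ : Measure Ω)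

theorem pr_nonneg {A : Type*} (X : Ω → A) (a : A) : 0 ≤ pr μ X a := ENNReal.toReal_nonneg

/-- Entropy is invariant under relabelling of the values. -/
theorem ent_equiv {A B : Type*} [Fintype A] [Fintype B] (e : A ≃ B) (X : Ω → A) :
    ent μ (fun ω => e (X ω)) = ent μ X := by
  unfold ent
  rw [← e.sum_comp]
  refine Finset.sum_congr rfl fun a _ => ?_
  have : (fun ω => e (X ω)) ⁻¹' {e a} = X ⁻¹' {a} := by
    ext ω
    simp
  simp only [pr, this]

/-- Fibres of a function of a finite-valued variable with measurable fibres are measurable. -/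
theorem measurableSet_fiber_comp {A B : Type*} [Finite A] {X : Ω → A}
    (hX : ∀ a, MeasurableSet (X ⁻¹' {a})) (f : A → B) (b : B) :
    MeasurableSet ((fun ω => f (X ω)) ⁻¹' {b}) := by
  have : (fun ω => f (X ω)) ⁻¹' {b} = ⋃ a ∈ {a | f a = b}, X ⁻¹' {a} := by
    ext ω
    simp
  rw [this]
  exact (Set.toFinite _).measurableSet_biUnion fun a _ => hX a

/-- Marginalization over the values of `X`. -/
theorem sum_pr_pair [IsFiniteMeasure μ] {A B : Type*} [Fintype A] (X : Ω → A) (Y : Ω → B)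
    (h : ∀ p : A × B, MeasurableSet ((fun ω => (X ω, Y ω)) ⁻¹' {p})) (b : B) :
    ∑ a, pr μ (fun ω => (X ω, Y ω)) (a, b) = pr μ Y b := by
  have hunion : Y ⁻¹' {b} = ⋃ a, (fun ω => (X ω, Y ω)) ⁻¹' {(a, b)} := by
    ext ω
    simp
  have hdisj : Pairwise (Function.onFun Disjoint
      fun a => (fun ω => (X ω, Y ω)) ⁻¹' {(a, b)}) := by
    intro a a' ne
    refine Set.disjoint_left.2 fun ω h₁ h₂ => ne ?_
    simp only [Set.mem_preimage, Set.mem_singleton_iff, Prod.mk.injEq] at h₁ h₂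
    exact h₁.1.symm.trans h₂.1
  unfold pr
  rw [hunion, measure_iUnion hdisj fun a => h (a, b), tsum_fintype,
    ENNReal.toReal_sum fun a _ => measure_ne_top μ _]

theorem sum_pr_triple_left [IsFiniteMeasure μ] {A B C : Type*} [Fintype A] [Finite B] [Finite C]
    (X : Ω → A) (Y : Ω → B) (Z : Ω → C)
    (h : ∀ p : A × B × C, MeasurableSet ((fun ω => (X ω, Y ω, Z ω)) ⁻¹' {p})) (b : B) (c : C) :
    ∑ a, pr μ (fun ω => (X ω, Y ω, Z ω)) (a, b, c) = pr μ (fun ω => (Y ω, Z ω)) (b, c) :=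
  sum_pr_pair μ X (fun ω => (Y ω, Z ω)) h (b, c)

theorem sum_pr_triple_middle [IsFiniteMeasure μ] {A B C : Type*} [Finite A] [Fintype B] [Finite C]
    (X : Ω → A) (Y : Ω → B) (Z : Ω → C)
    (h : ∀ p : A × B × C, MeasurableSet ((fun ω => (X ω, Y ω, Z ω)) ⁻¹' {p})) (a : A) (c : C) :
    ∑ b, pr μ (fun ω => (X ω, Y ω, Z ω)) (a, b, c) = pr μ (fun ω => (X ω, Z ω)) (a, c) := by
  rw [← sum_pr_pair μ Y (fun ω => (X ω, Z ω))
    (measurableSet_fiber_comp h fun p => (p.2.1, p.1, p.2.2)) (a, c)]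
  refine Finset.sum_congr rfl fun b _ => ?_
  have : (fun ω => (X ω, Y ω, Z ω)) ⁻¹' {(a, b, c)}
      = (fun ω => (Y ω, X ω, Z ω)) ⁻¹' {(b, a, c)} := by
    ext ω
    simp only [Set.mem_preimage, Set.mem_singleton_iff, Prod.mk.injEq]
    tauto
  simp only [pr, this]

theorem sum_pr_pair_of_triple [IsFiniteMeasure μ] {A B C : Type*} [Fintype A] [Finite B] [Finite C]
    (X : Ω → A) (Y : Ω → B) (Z : Ω → C)
    (h : ∀ p : A × B × C, MeasurableSet ((fun ω => (X ω, Y ω, Z ω)) ⁻¹' {p})) (c : C) :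
    ∑ a, pr μ (fun ω => (X ω, Z ω)) (a, c) = pr μ Z c :=
  sum_pr_pair μ X Z (measurableSet_fiber_comp h fun p => (p.1, p.2.2)) c

/-- Conditional mutual information as a sum over the values of the conditioning variable. -/
theorem cmi_eq_sum {A B C : Type*} [Fintype A] [Fintype B] [Fintype C]
    (X : Ω → A) (Y : Ω → B) (Z : Ω → C) :
    cmi μ X Y Z = ∑ c, ((∑ a, Real.negMulLog (pr μ (fun ω => (X ω, Z ω)) (a, c)))
      + (∑ b, Real.negMulLog (pr μ (fun ω => (Y ω, Z ω)) (b, c)))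
      - (∑ a, ∑ b, Real.negMulLog (pr μ (fun ω => (X ω, Y ω, Z ω)) (a, b, c)))
      - Real.negMulLog (pr μ Z c)) := by
  have triple : ∑ a, ∑ b, ∑ c, Real.negMulLog (pr μ (fun ω => (X ω, Y ω, Z ω)) (a, b, c))
      = ∑ c, ∑ a, ∑ b, Real.negMulLog (pr μ (fun ω => (X ω, Y ω, Z ω)) (a, b, c)) := by
    rw [Finset.sum_comm (s := (Finset.univ : Finset C))]
    exact Finset.sum_congr rfl fun a _ => Finset.sum_comm
  simp only [cmi, ent, Fintype.sum_prod_type, Finset.sum_sub_distrib, Finset.sum_add_distrib]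
  rw [triple, Finset.sum_comm (s := (Finset.univ : Finset A)) (t := (Finset.univ : Finset C)),
    Finset.sum_comm (s := (Finset.univ : Finset B)) (t := (Finset.univ : Finset C))]

theorem cmi_nonneg [IsFiniteMeasure μ] {A B C : Type*} [Fintype A] [Fintype B] [Fintype C]
    (X : Ω → A) (Y : Ω → B) (Z : Ω → C)
    (h : ∀ p : A × B × C, MeasurableSet ((fun ω => (X ω, Y ω, Z ω)) ⁻¹' {p})) :
    0 ≤ cmi μ X Y Z := by
  rw [cmi_eq_sum]
  refine Finset.sum_nonneg fun c _ => ?_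
  have key := sum_negMulLog_marginals_sub_nonneg
    (fun a b => pr μ (fun ω => (X ω, Y ω, Z ω)) (a, b, c)) fun a b => pr_nonneg μ _ _
  simp only [sum_pr_triple_left μ X Y Z h, sum_pr_triple_middle μ X Y Z h,
    sum_pr_pair_of_triple μ X Y Z h] at key
  exact key

/-- Conditional mutual information vanishes under conditional independence. -/
theorem cmi_eq_zero [IsFiniteMeasure μ] {A B C : Type*} [Fintype A] [Fintype B] [Fintype C]
    (X : Ω → A) (Y : Ω → B) (Z : Ω → C)
    (h : ∀ p : A × B × C, MeasurableSet ((fun ω => (X ω, Y ω, Z ω)) ⁻¹' {p}))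
    (hindep : ∀ a b c, pr μ (fun ω => (X ω, Y ω, Z ω)) (a, b, c) * pr μ Z c
      = pr μ (fun ω => (X ω, Z ω)) (a, c) * pr μ (fun ω => (Y ω, Z ω)) (b, c)) :
    cmi μ X Y Z = 0 := by
  rw [cmi_eq_sum]
  refine Finset.sum_eq_zero fun c _ => ?_
  have key := sum_negMulLog_marginals_sub_eq_zero
    (fun a b => pr μ (fun ω => (X ω, Y ω, Z ω)) (a, b, c)) (fun a b => pr_nonneg μ _ _)
  simp only [sum_pr_triple_left μ X Y Z h, sum_pr_triple_middle μ X Y Z h,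
    sum_pr_pair_of_triple μ X Y Z h] at key
  exact key fun a b => hindep a b c

section Permutations

variable {A B C D : Type*} [Fintype A] [Fintype B] [Fintype C] [Fintype D]
  (X : Ω → A) (Y : Ω → B) (Z : Ω → C) (W : Ω → D)

theorem ent_swap : ent μ (fun ω => (X ω, Y ω)) = ent μ (fun ω => (Y ω, X ω)) :=
  ent_equiv μ (Equiv.prodComm B A) fun ω => (Y ω, X ω)

theorem ent_assoc :
    ent μ (fun ω => ((X ω, Y ω), Z ω)) = ent μ (fun ω => (X ω, Y ω, Z ω)) :=
  ent_equiv μ (Equiv.prodAssoc A B C).symm fun ω => (X ω, Y ω, Z ω)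

theorem ent_rotate :
    ent μ (fun ω => (X ω, Y ω, Z ω)) = ent μ (fun ω => (Y ω, Z ω, X ω)) := by
  rw [ent_swap μ X fun ω => (Y ω, Z ω), ent_assoc]

theorem ent_swap_right :
    ent μ (fun ω => (X ω, Y ω, Z ω)) = ent μ (fun ω => (X ω, Z ω, Y ω)) :=
  ent_equiv μ ((Equiv.refl A).prodCongr (Equiv.prodComm C B)) fun ω => (X ω, Z ω, Y ω)

theorem ent_rotate_right :
    ent μ (fun ω => (X ω, Y ω, Z ω, W ω)) = ent μ (fun ω => (X ω, W ω, Y ω, Z ω)) :=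
  ent_equiv μ ((Equiv.refl A).prodCongr
    ((Equiv.prodComm D (B × C)).trans (Equiv.prodAssoc B C D))) fun ω => (X ω, W ω, Y ω, Z ω)

end Permutations

end Entropy

/-- If `X1` and `X2` are conditionally independent given `U` (all random
variables taking values in finite sets, jointly distributed with a further random
variable `Y`), then `I(X1,X2 ; Y | U) ≤ I(X1 ; Y | U, X2) + I(X2 ; Y | U, X1)`. -/
theorem statement2 {Ω : Type*} [MeasurableSpace Ω] (μ : Measure Ω) [IsProbabilityMeasure μ]
    {A1 A2 AU AY : Type*} [Fintype A1] [Fintype A2] [Fintype AU] [Fintype AY]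
    (X1 : Ω → A1) (X2 : Ω → A2) (U : Ω → AU) (Y : Ω → AY)
    (hmeas : ∀ (a : A1) (b : A2) (u : AU) (y : AY),
      MeasurableSet ((fun ω => (X1 ω, X2 ω, U ω, Y ω)) ⁻¹' {(a, b, u, y)}))
    (hcondindep : ∀ (a : A1) (b : A2) (u : AU),
      pr μ (fun ω => (X1 ω, X2 ω, U ω)) (a, b, u) * pr μ U u
        = pr μ (fun ω => (X1 ω, U ω)) (a, u) * pr μ (fun ω => (X2 ω, U ω)) (b, u)) :
    cmi μ (fun ω => (X1 ω, X2 ω)) Y U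
      ≤ cmi μ X1 Y (fun ω => (U ω, X2 ω)) + cmi μ X2 Y (fun ω => (U ω, X1 ω)) := by
  have hfour : ∀ p : A1 × A2 × AU × AY,
      MeasurableSet ((fun ω => (X1 ω, X2 ω, U ω, Y ω)) ⁻¹' {p}) :=
    fun p => hmeas p.1 p.2.1 p.2.2.1 p.2.2.2
  have hzero := cmi_eq_zero μ X1 X2 U
    (measurableSet_fiber_comp hfour fun p => (p.1, p.2.1, p.2.2.1)) hcondindep
  have hnonneg := cmi_nonneg μ X1 X2 (fun ω => (U ω, Y ω)) hfour
  have h12YU : ent μ (fun ω => ((X1 ω, X2 ω), Y ω, U ω))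
      = ent μ (fun ω => (X1 ω, X2 ω, U ω, Y ω)) := by
    rw [ent_swap_right μ (fun ω => (X1 ω, X2 ω)) Y U, ent_assoc]
  have h1YU2 : ent μ (fun ω => (X1 ω, Y ω, U ω, X2 ω))
      = ent μ (fun ω => (X1 ω, X2 ω, U ω, Y ω)) := by
    rw [ent_rotate_right, ← ent_assoc, ent_swap_right, ent_assoc]
  have h2YU1 : ent μ (fun ω => (X2 ω, Y ω, U ω, X1 ω))
      = ent μ (fun ω => (X1 ω, X2 ω, U ω, Y ω)) := by
    rw [ent_rotate_right, ← ent_assoc, ent_swap_right μ _ Y U,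
      ← ent_equiv μ ((Equiv.prodComm A2 A1).prodCongr (Equiv.refl (AU × AY)))]
    exact ent_assoc μ X1 X2 fun ω => (U ω, Y ω)
  simp only [cmi] at hzero hnonneg ⊢
  rw [ent_assoc μ X1 X2 U, h12YU, h1YU2, h2YU1, ent_swap μ Y U, ent_swap_right μ X1 U X2,
    ent_rotate μ Y U X2, ent_rotate μ U X2 Y, ent_swap_right μ X2 Y U,
    ent_swap μ U X2, ← ent_rotate μ X1 X2 U, ent_rotate μ Y U X1, ent_rotate μ U X1 Y,
    ent_swap_right μ X1 Y U, ent_swap μ U X1]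
  linarith
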